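/- For all n ∈ I and all 1 ≤ k ≤ n, the expectation of Z_k under the conditional Galton–Watson tree τ_n satisfies E_{τ_n}[Z_k] = n·P(S_k = −1)·P(S_{n−k} = 0) / (k·P(S_n = −1)). Moreover, for 1 ≤ k ≤ (n−1)/2, E_{τ_n}[Z_k(Z_k − 1)] = n·(n − 2k + 1)·P(S_k = −1)²·P(S_{n−2k} = 1) / (k²·P(S_n = −1)), while E_{τ_n}[Z_k(Z_k − 1)] = 0 for k > (n−1)/2. -/

import Mathlib

/-! Finite ordered rooted (plane) trees: a tree is a finite list of its root subtrees. -/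
inductive PTree : Type where
  | node : List PTree → PTree

namespace PTree

/-- the number of nodes of the tree -/
def size : PTree → ℕ
  | node ts => 1 + (ts.attach.map (fun x => size x.1)).sum
decreasing_by
  have := List.sizeOf_lt_of_mem x.2
  simp only [node.sizeOf_spec]; omega

/-- the list of all subtrees rooted at the nodes of the tree -/
def subtrees : PTree → List PTree
  | node ts => node ts :: (ts.attach.map (fun x => subtrees x.1)).flatten
decreasing_by
  have := List.sizeOf_lt_of_mem x.2
  simp only [node.sizeOf_spec]; omega

/-- the height of the tree (maximal distance from the root to a node) -/
def height : PTree → ℕ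
  | node ts => (ts.attach.map (fun x => height x.1 + 1)).foldr max 0
decreasing_by
  have := List.sizeOf_lt_of_mem x.2
  simp only [node.sizeOf_spec]; omega

/-- the number of children of the root (`ξ_ε`) -/
def rootDeg : PTree → ℕ
  | node ts => ts.length

/-- the sizes of the subtrees rooted at the children of the root -/
def childSizes : PTree → List ℕ
  | node ts => ts.map size

/-- the sizes of the subtrees rooted at the children of the root,
sorted from largest to smallest -/
def sortedSizesDesc (T : PTree) : List ℕ :=
  T.childSizes.insertionSort (· ≥ ·)

/-- `N_k`: the `k`-th largest among the sizes of the subtrees rooted at the children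
of the root (`0` if there are fewer than `k` children) -/
def Nk (k : ℕ) (T : PTree) : ℕ := (sortedSizesDesc T).getD (k - 1) 0

/-- `N_{k+} = N_k + N_{k+1} + ⋯` -/
def NkPlus (k : ℕ) (T : PTree) : ℕ := ((sortedSizesDesc T).drop (k - 1)).sum

/-- the subtrees rooted at the nodes of the heavy path: starting at the root, always
continue to the first child of maximal subtree size -/
def heavyPath : PTree → List PTree
  | node ts =>
    node ts ::
      (match ts.attach.find? (fun x => x.1.size = ((ts.map size).foldr max 0)) with
       | some x => heavyPath x.1
       | none => [])
decreasing_by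
  have := List.sizeOf_lt_of_mem x.2
  simp only [node.sizeOf_spec]; omega

end PTree

/-- `Z_k`: the number of nodes `v` of the tree whose subtree has size `k` -/
def Zk (k : ℕ) (T : PTree) : ℕ := (T.subtrees.filter (fun s => s.size = k)).length

/-- the rank (`1` = largest) of the `i`-th child (0-based) among siblings whose subtree
sizes are given by the list `sizes`; ties are broken from left to right -/
def rankIn (sizes : List ℕ) (i : ℕ) : ℕ :=
  1 + ((List.range sizes.length).filter (fun j =>
        sizes.getD i 0 < sizes.getD j 0 ∨ (sizes.getD j 0 = sizes.getD i 0 ∧ j < i))).length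

mutual
/-- the number of nodes of the `k`-heavy tree: the root together with all nodes `v` such
that `v` and every non-root ancestor of `v` has rank at most `k` among its siblings -/
def heavySize (k : ℕ) : PTree → ℕ
  | .node ts => 1 + heavySizeAux k (ts.map PTree.size) 0 ts
def heavySizeAux (k : ℕ) (sizes : List ℕ) : ℕ → List PTree → ℕ
  | _, [] => 0
  | i, t :: rest =>
      (if rankIn sizes i ≤ k then heavySize k t else 0) + heavySizeAux k sizes (i + 1) rest
end

/-- `H*(v,ℓ)`: the height of the subtree rooted at the child of rank `ℓ` of the root of `v`
(`0` if there are fewer than `ℓ` children) -/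
def Hstar : PTree → ℕ → ℕ
  | .node ts, ℓ =>
    match (List.range ts.length).find? (fun i => rankIn (ts.map PTree.size) i = ℓ) with
    | some i => (ts.getD i (.node [])).height
    | none => 0

/-- the weight of a tree: the product over all nodes `v` of `p (number of children of v)` -/
noncomputable def weight (p : ℕ → ℝ) : PTree → ℝ
  | .node ts => p ts.length * (ts.attach.map (fun x => weight p x.1)).prod
decreasing_by
  have := List.sizeOf_lt_of_mem x.2
  simp only [PTree.node.sizeOf_spec]; omega

/-- the total weight of all trees of size `n` -/
noncomputable def treeSum (p : ℕ → ℝ) (n : ℕ) : ℝ :=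
  ∑' T : {T : PTree // T.size = n}, weight p T.1

/-- the probability of the event `A` under the conditional Galton-Watson tree `τ_n` -/
noncomputable def condProb (p : ℕ → ℝ) (n : ℕ) (A : PTree → Prop) : ℝ :=
  (∑' T : {T : PTree // T.size = n ∧ A T}, weight p T.1) / treeSum p n

/-- the expectation of `f` under the conditional Galton-Watson tree `τ_n` -/
noncomputable def condExp (p : ℕ → ℝ) (n : ℕ) (f : PTree → ℝ) : ℝ :=
  (∑' T : {T : PTree // T.size = n}, weight p T.1 * f T.1) / treeSum p n

/-- the variance of `f` under the conditional Galton-Watson tree `τ_n` -/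
noncomputable def condVar (p : ℕ → ℝ) (n : ℕ) (f : PTree → ℝ) : ℝ :=
  condExp p n (fun T => f T ^ 2) - (condExp p n f) ^ 2

/-- the set `I = {n ≥ 1 : Σ_{|T| = n} w(T) > 0}` of sizes of positive probability -/
def gwSupport (p : ℕ → ℝ) : Set ℕ := {n | 1 ≤ n ∧ 0 < treeSum p n}

/-- `P(S_m = x)` for the random walk `S_m = (ξ_1 - 1) + ⋯ + (ξ_m - 1)`, `ξ_i` i.i.d. `∼ p` -/
noncomputable def walkProb (p : ℕ → ℝ) (m : ℕ) (x : ℤ) : ℝ :=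
  ∑' a : Fin m → ℕ, if (∑ i, ((a i : ℤ) - 1)) = x then ∏ i, p (a i) else 0

/-- `I_n = {1 ≤ k ≤ n : P(S_{n-k} = 0) > 0}` -/
def walkSupportIn (p : ℕ → ℝ) (n : ℕ) : Set ℕ :=
  {k | 1 ≤ k ∧ k ≤ n ∧ 0 < walkProb p (n - k) 0}

/-- `h = gcd {i > 0 : p_i > 0}`, defined as the largest common divisor of the support -/
noncomputable def gcdSupp (p : ℕ → ℝ) : ℕ :=
  sSup {d : ℕ | 0 < d ∧ ∀ i : ℕ, 0 < i → 0 < p i → d ∣ i}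

/-- `α = h / (σ √(2π))` where `σ² = Σ i² p_i - 1` -/
noncomputable def gwAlpha (p : ℕ → ℝ) : ℝ :=
  (gcdSupp p : ℝ) /
    (Real.sqrt ((∑' i : ℕ, (i : ℝ) ^ 2 * p i) - 1) * Real.sqrt (2 * Real.pi))

/-- the moment `E[ξ^m] = Σ i^m p_i` is finite -/
def MomentFinite (p : ℕ → ℝ) (m : ℝ) : Prop :=
  Summable (fun i : ℕ => (i : ℝ) ^ m * p i)

section Lagrange

open PowerSeries

lemma coeff_derivative_mul_pow (φ : ℝ⟦X⟧) (m n : ℕ) :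
    ((m : ℝ) + 1) * coeff n (d⁄dX ℝ φ * φ ^ m) = (n + 1) * coeff (n + 1) (φ ^ (m + 1)) := by
  have h : d⁄dX ℝ (φ ^ (m + 1)) = C ((m : ℝ) + 1) * (d⁄dX ℝ φ * φ ^ m) := by
    rw [PowerSeries.derivative_pow]
    simp
    ring
  have h2 := congrArg (coeff n) h
  rw [coeff_derivative, coeff_C_mul] at h2
  rw [← h2, mul_comm]

variable (Ψ : ℝ⟦X⟧ →ₐ[ℝ] ℝ⟦X⟧) (φ G K : ℝ⟦X⟧)

lemma algHom_apply_C (r : ℝ) : Ψ (C r) = C r := Ψ.commutes r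

lemma algHom_apply_X_mul_add_C (H : ℝ⟦X⟧) (r : ℝ) :
    Ψ (X * H + C r) = Ψ X * Ψ H + C r := by
  rw [map_add, map_mul, algHom_apply_C]

/-- Lagrange inversion: if `T = X φ(T)` and `G = 1 / (1 - X φ'(T))`, then
`[x ^ m] H(T) G = [y ^ m] H φ ^ m`. -/
lemma coeff_lagrange (hT : Ψ X = X * Ψ φ) (hG : G = 1 + X * (Ψ (d⁄dX ℝ φ) * G))
    (m : ℕ) (H : ℝ⟦X⟧) : coeff m (Ψ H * G) = coeff m (H * φ ^ m) := by
  induction m generalizing H with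
  | zero =>
    rw [H.eq_X_mul_shift_add_const, algHom_apply_X_mul_add_C, hT, hG]
    simp
  | succ m ih =>
    have hd := coeff_derivative_mul_pow φ m m
    have hm : (m : ℝ) + 1 ≠ 0 := by positivity
    replace hd := mul_left_cancel₀ hm hd
    obtain ⟨H₁, r, rfl⟩ : ∃ H₁ r, H = X * H₁ + C r := ⟨_, _, H.eq_X_mul_shift_add_const⟩
    have h1 : Ψ (X * H₁ + C r) * G
        = X * (Ψ (H₁ * φ) * G) + C r * (1 + X * (Ψ (d⁄dX ℝ φ) * G)) := by
      rw [← hG, algHom_apply_X_mul_add_C, hT, map_mul]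
      ring
    have h2 : (X * H₁ + C r) * φ ^ (m + 1) = X * (H₁ * φ * φ ^ m) + C r * φ ^ (m + 1) := by ring
    rw [h1, h2, map_add, map_add, coeff_succ_X_mul, coeff_succ_X_mul, coeff_C_mul, coeff_C_mul,
      map_add, coeff_succ_X_mul, ih, ih, hd]
    simp [coeff_one]

/-- The second-order companion of `coeff_lagrange`. -/
lemma coeff_lagrange_second (hT : Ψ X = X * Ψ φ) (hG : G = 1 + X * (Ψ (d⁄dX ℝ φ) * G))
    (hK : K = X * (Ψ (d⁄dX ℝ (d⁄dX ℝ φ)) * G ^ 2 + Ψ (d⁄dX ℝ φ) * K)) (m : ℕ) (H : ℝ⟦X⟧) :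
    coeff m (Ψ (d⁄dX ℝ H) * G ^ 2 + Ψ H * K) = (m + 1) * coeff (m + 1) (H * φ ^ m) := by
  induction m generalizing H with
  | zero =>
    have h0 : coeff 0 (Ψ (d⁄dX ℝ H) * G) = coeff 0 (d⁄dX ℝ H) := by
      simpa using coeff_lagrange Ψ φ G hT hG 0 (d⁄dX ℝ H)
    have hG0 : constantCoeff G = 1 := by rw [hG]; simp
    have hK0 : constantCoeff K = 0 := by rw [hK]; simp
    rw [coeff_derivative] at h0
    simp [hG0, hK0] at h0 ⊢
    exact h0
  | succ m ih =>
    have hd := coeff_derivative_mul_pow φ m (m + 1)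
    obtain ⟨H₁, r, rfl⟩ : ∃ H₁ r, H = X * H₁ + C r := ⟨_, _, H.eq_X_mul_shift_add_const⟩
    have hder : d⁄dX ℝ (X * H₁ + C r) = H₁ + X * d⁄dX ℝ H₁ := by
      rw [map_add, derivative_C, Derivation.leibniz, derivative_X]
      simp [add_comm]
    have hder2 : d⁄dX ℝ (H₁ * φ) = H₁ * d⁄dX ℝ φ + d⁄dX ℝ H₁ * φ := by
      rw [Derivation.leibniz]
      simp [mul_comm]
    have hG2 : G ^ 2 = G + X * (Ψ (d⁄dX ℝ φ) * G ^ 2) := by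
      linear_combination G * hG
    have h1 : Ψ (d⁄dX ℝ (X * H₁ + C r)) * G ^ 2 + Ψ (X * H₁ + C r) * K
        = Ψ H₁ * G + X * (Ψ (d⁄dX ℝ (H₁ * φ)) * G ^ 2 + Ψ (H₁ * φ) * K)
          + C r * (X * (Ψ (d⁄dX ℝ (d⁄dX ℝ φ)) * G ^ 2 + Ψ (d⁄dX ℝ φ) * K)) := by
      rw [← hK, hder, hder2, algHom_apply_X_mul_add_C]
      simp only [map_add, map_mul, hT]
      linear_combination Ψ H₁ * hG2
    have h2 : (X * H₁ + C r) * φ ^ (m + 1) = X * (H₁ * φ ^ (m + 1)) + C r * φ ^ (m + 1) := by ring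
    have h3 : H₁ * φ * φ ^ m = H₁ * φ ^ (m + 1) := by ring
    rw [h1, h2, map_add, map_add, coeff_lagrange Ψ φ G hT hG, coeff_succ_X_mul, coeff_C_mul,
      coeff_succ_X_mul, ih, ih, map_add, coeff_succ_X_mul, coeff_C_mul, h3]
    push_cast at hd ⊢
    linear_combination r * hd

/-- Lagrange inversion for the solution `T` of `T = X φ(T)` itself. -/
lemma mul_coeff_lagrange_X (hT : Ψ X = X * Ψ φ) (hG : G = 1 + X * (Ψ (d⁄dX ℝ φ) * G)) (m : ℕ) :
    ((m : ℝ) + 1) * coeff (m + 1) (Ψ X) = coeff m (φ ^ (m + 1)) := by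
  have h1 : Ψ X = Ψ X * G - X * (Ψ (X * d⁄dX ℝ φ) * G) := by
    rw [map_mul]
    linear_combination - Ψ X * hG
  have h2 : X * d⁄dX ℝ φ * φ ^ m = X * (d⁄dX ℝ φ * φ ^ m) := by ring
  rw [h1, map_sub, coeff_succ_X_mul, coeff_lagrange Ψ φ G hT hG, coeff_lagrange Ψ φ G hT hG,
    coeff_succ_X_mul, h2]
  cases m with
  | zero => simp
  | succ m =>
    have hd := coeff_derivative_mul_pow φ (m + 1) m
    rw [coeff_succ_X_mul]
    push_cast at hd ⊢
    linear_combination -hd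

/-- Truncating a power series `H` in the coefficients of `H(T) A`, where `T` has no constant term. -/
lemma coeff_algHom_mul (hT : constantCoeff (Ψ X) = 0) (H A : ℝ⟦X⟧) {n N : ℕ} (hN : n < N) :
    coeff n (Ψ H * A) = ∑ d ∈ Finset.range N, coeff d H * coeff n (Ψ X ^ d * A) := by
  induction N generalizing H A n with
  | zero => omega
  | succ N ih =>
    obtain ⟨S, hS⟩ := X_dvd_iff.mpr hT
    obtain ⟨H₁, r, rfl⟩ : ∃ H₁ r, H = X * H₁ + C r := ⟨_, _, H.eq_X_mul_shift_add_const⟩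
    have h1 : Ψ (X * H₁ + C r) * A = X * (Ψ H₁ * (S * A)) + C r * A := by
      rw [algHom_apply_X_mul_add_C, hS]; ring
    rw [h1, map_add, coeff_C_mul, Finset.sum_range_succ']
    congr 1
    · cases n with
      | zero =>
        symm
        simp [hS, pow_succ]
      | succ n =>
        rw [coeff_succ_X_mul, ih _ _ (by omega)]
        refine Finset.sum_congr rfl fun d _ ↦ ?_
        have h2 : Ψ X ^ (d + 1) * A = X * (Ψ X ^ d * (S * A)) := by rw [pow_succ, hS]; ring
        rw [h2, coeff_succ_X_mul]
        simp
    · simp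

end Lagrange

section Walk

open PowerSeries

lemma walkProb_eq_coeff (p : ℕ → ℝ) (m N : ℕ) (x : ℤ) (hx : (m : ℤ) + x = N) :
    walkProb p m x = coeff N (PowerSeries.mk p ^ m) := by
  classical
  have hpow : PowerSeries.mk p ^ m = ∏ _i : Fin m, PowerSeries.mk p := by simp
  have hcond (a : Fin m → ℕ) : ∑ i, ((a i : ℤ) - 1) = x ↔ ∑ i, a i = N := by
    rw [Finset.sum_sub_distrib]
    simp only [Finset.sum_const, Finset.card_univ, Fintype.card_fin, mul_one,
      nsmul_eq_mul, ← Nat.cast_sum]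
    omega
  rw [hpow, coeff_prod, walkProb, tsum_eq_sum (s := Finset.piAntidiag Finset.univ N)]
  · refine Finset.sum_bij' (fun a _ ↦ Finsupp.equivFunOnFinite.symm a) (fun l _ ↦ ⇑l) ?_ ?_ ?_ ?_ ?_
    · intro a ha
      simpa [Finset.mem_finsuppAntidiag] using ha
    · intro l hl
      simpa [Finset.mem_finsuppAntidiag] using hl
    · intro a _
      rfl
    · intro l _
      simp
    · intro a ha
      rw [if_pos ((hcond a).2 (by simpa using ha))]
      simp
  · intro a ha
    rw [if_neg]
    rw [hcond]
    simpa using ha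

end Walk

namespace PTree

lemma size_node (ts : List PTree) : (node ts).size = 1 + (ts.map size).sum := by
  rw [size, List.attach_map_val]

lemma size_pos (T : PTree) : 0 < T.size := by
  cases T
  rw [size_node]
  omega

lemma subtrees_node (ts : List PTree) :
    (node ts).subtrees = node ts :: (ts.map subtrees).flatten := by
  rw [subtrees, List.attach_map_val]

lemma length_le_sum_size (ts : List PTree) : ts.length ≤ (ts.map size).sum := by
  induction ts with
  | nil => simp
  | cons T ts ih =>
    have := T.size_pos
    simp only [List.length_cons, List.map_cons, List.sum_cons]
    omega

lemma finite_forests (n : ℕ) : {ts : List PTree | (ts.map size).sum = n}.Finite := by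
  induction n using Nat.strong_induction_on with
  | _ n ih =>
    have hfin : (⋃ i ∈ Finset.range n, ⋃ j ∈ Finset.range n,
        Set.image2 (fun a b : List PTree ↦ node a :: b) {ts | (ts.map size).sum = i}
          {ts | (ts.map size).sum = j}).Finite :=
      Set.Finite.biUnion (Finset.finite_toSet _) fun i hi ↦
        Set.Finite.biUnion (Finset.finite_toSet _) fun j hj ↦
          (ih i (by simpa using hi)).image2 _ (ih j (by simpa using hj))
    refine (hfin.union (Set.finite_singleton [])).subset ?_
    rintro (_ | ⟨⟨a⟩, b⟩) h
    · simp
    · left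
      have hs := size_node a
      simp only [Set.mem_ofPred_eq, List.map_cons, List.sum_cons] at h
      simp only [Set.mem_iUnion, Finset.mem_range]
      exact ⟨_, by omega, _, by omega, a, rfl, b, rfl, rfl⟩

lemma finite_size_eq (n : ℕ) : {T : PTree | T.size = n}.Finite := by
  refine ((finite_forests n).preimage (f := fun T ↦ [T]) ?_).subset ?_
  · intro a _ b _ h
    simpa using h
  · intro T hT
    simpa using hT

end PTree

lemma weight_node (p : ℕ → ℝ) (ts : List PTree) :
    weight p (.node ts) = p ts.length * (ts.map (weight p)).prod := by
  rw [weight, List.attach_map_val]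

lemma Zk_node (k : ℕ) (ts : List PTree) :
    Zk k (.node ts) = (if (PTree.node ts).size = k then 1 else 0) + (ts.map (Zk k)).sum := by
  have h : (((ts.map PTree.subtrees).flatten).filter (fun s => s.size = k)).length
      = (ts.map (Zk k)).sum := by
    induction ts with
    | nil => simp
    | cons T ts ih =>
      rw [List.map_cons, List.flatten_cons, List.filter_append, List.length_append, ih, List.map_cons,
        List.sum_cons, Zk]
  rw [Zk, PTree.subtrees_node, List.filter_cons, ← h]
  split_ifs <;> simp_all [add_comm]

lemma Zk_eq_zero_of_size_lt (k : ℕ) (T : PTree) (hT : T.size < k) : Zk k T = 0 := by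
  induction hs : T.size using Nat.strong_induction_on generalizing T with
  | _ n ih =>
    obtain ⟨ts⟩ := T
    rw [Zk_node, if_neg hT.ne, zero_add, List.sum_eq_zero_iff]
    intro z hz
    obtain ⟨T, hT', rfl⟩ := List.mem_map.1 hz
    have hle := List.le_sum_of_mem (List.mem_map_of_mem (f := PTree.size) hT')
    rw [PTree.size_node] at hs hT
    exact ih T.size (by omega) T (by omega) rfl

lemma sum_Zk_eq_zero (k : ℕ) (ts : List PTree) (h : (PTree.node ts).size ≤ k) :
    (ts.map (Zk k)).sum = 0 := by
  rw [List.sum_eq_zero_iff]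
  intro z hz
  obtain ⟨T, hT', rfl⟩ := List.mem_map.1 hz
  have hle := List.le_sum_of_mem (List.mem_map_of_mem (f := PTree.size) hT')
  rw [PTree.size_node] at h
  exact Zk_eq_zero_of_size_lt k T (by omega)

section GeneratingFunctions

open PowerSeries

/-- The finite set of trees with `n` nodes. -/
noncomputable def treeFinset (n : ℕ) : Finset PTree := (PTree.finite_size_eq n).toFinset

lemma mem_treeFinset {n : ℕ} {T : PTree} : T ∈ treeFinset n ↔ T.size = n := by
  simp [treeFinset]

/-- The finite set of forests with `d` trees and `n` nodes in total. -/
noncomputable def forestFinset (d n : ℕ) : Finset (List PTree) :=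
  (PTree.finite_forests n).toFinset.filter (fun ts ↦ ts.length = d)

lemma mem_forestFinset {d n : ℕ} {ts : List PTree} :
    ts ∈ forestFinset d n ↔ (ts.map PTree.size).sum = n ∧ ts.length = d := by
  simp [forestFinset]

lemma sum_treeFinset_succ (f : PTree → ℝ) (n : ℕ) :
    ∑ T ∈ treeFinset (n + 1), f T
      = ∑ d ∈ Finset.range (n + 1), ∑ ts ∈ forestFinset d n, f (.node ts) := by
  rw [Finset.sum_sigma']
  refine Finset.sum_bij' (fun T _ ↦ ⟨T.rootDeg, match T with | .node ts => ts⟩)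
    (fun x _ ↦ .node x.2) ?_ ?_ ?_ ?_ ?_
  · rintro ⟨ts⟩ h
    rw [mem_treeFinset, PTree.size_node] at h
    have := PTree.length_le_sum_size ts
    refine Finset.mem_sigma.2 ⟨Finset.mem_range.2 ?_, mem_forestFinset.2 ⟨?_, rfl⟩⟩
    · change ts.length < n + 1
      omega
    · change (ts.map PTree.size).sum = n
      omega
  · rintro ⟨d, ts⟩ h
    simp only [Finset.mem_sigma, Finset.mem_range, mem_forestFinset] at h
    rw [mem_treeFinset, PTree.size_node, h.2.1, add_comm]
  · rintro ⟨ts⟩ _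
    rfl
  · rintro ⟨d, ts⟩ h
    simp only [Finset.mem_sigma, Finset.mem_range, mem_forestFinset] at h
    obtain ⟨-, -, rfl⟩ := h
    rfl
  · rintro ⟨ts⟩ _
    rfl

lemma sum_forestFinset_succ (f : List PTree → ℝ) (d n : ℕ) :
    ∑ ts ∈ forestFinset (d + 1) n, f ts
      = ∑ x ∈ Finset.HasAntidiagonal.antidiagonal n,
          ∑ T ∈ treeFinset x.1, ∑ ts ∈ forestFinset d x.2, f (T :: ts) := by
  simp only [← Finset.sum_product', Finset.sum_sigma']
  refine Finset.sum_bij'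
    (fun ts _ ↦ ⟨⟨(ts.headD (.node [])).size, (ts.tail.map PTree.size).sum⟩,
      ⟨ts.headD (.node []), ts.tail⟩⟩)
    (fun x _ ↦ x.2.1 :: x.2.2) ?_ ?_ ?_ ?_ ?_
  · rintro (_ | ⟨T, ts⟩) h
    · simp [mem_forestFinset] at h
    · simpa [mem_forestFinset, mem_treeFinset] using h
  · rintro ⟨⟨i, j⟩, ⟨T, ts⟩⟩ h
    simp only [Finset.mem_sigma, Finset.HasAntidiagonal.mem_antidiagonal, Finset.mem_product, mem_treeFinset,
      mem_forestFinset] at h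
    simp only [mem_forestFinset, List.map_cons, List.sum_cons, List.length_cons]
    omega
  · rintro (_ | ⟨T, ts⟩) h
    · simp [mem_forestFinset] at h
    · rfl
  · rintro ⟨⟨i, j⟩, ⟨T, ts⟩⟩ h
    simp only [Finset.mem_sigma, Finset.HasAntidiagonal.mem_antidiagonal, Finset.mem_product, mem_treeFinset,
      mem_forestFinset] at h
    obtain ⟨-, rfl, rfl, -⟩ := h
    rfl
  · rintro (_ | ⟨T, ts⟩) h
    · simp [mem_forestFinset] at h
    · rfl

/-- The weighted generating function of a tree functional `f`. -/
noncomputable def treeGF (p : ℕ → ℝ) (f : PTree → ℝ) : ℝ⟦X⟧ :=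
  PowerSeries.mk fun n ↦ ∑ T ∈ treeFinset n, weight p T * f T

/-- The weighted generating function of a functional `f` on forests with `d` trees. -/
noncomputable def forestGF (p : ℕ → ℝ) (d : ℕ) (f : List PTree → ℝ) : ℝ⟦X⟧ :=
  PowerSeries.mk fun n ↦ ∑ ts ∈ forestFinset d n, (ts.map (weight p)).prod * f ts

lemma forestGF_zero (p : ℕ → ℝ) (f : List PTree → ℝ) : forestGF p 0 f = C (f []) := by
  ext n
  rw [forestGF, coeff_mk, coeff_C]
  have h : forestFinset 0 n = if n = 0 then {[]} else ∅ := by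
    ext ts
    rw [mem_forestFinset]
    split_ifs with hn
    · cases ts <;> simp [hn]
    · cases ts <;> simp [Ne.symm hn]
  rw [h]
  split_ifs <;> simp

lemma forestGF_succ_mul (p : ℕ → ℝ) (d : ℕ) (g : PTree → ℝ) (h : List PTree → ℝ)
    (f : List PTree → ℝ) (hf : ∀ T ts, f (T :: ts) = g T * h ts) :
    forestGF p (d + 1) f = treeGF p g * forestGF p d h := by
  ext n
  rw [forestGF, coeff_mk, coeff_mul, sum_forestFinset_succ]
  simp only [treeGF, forestGF, coeff_mk, Finset.sum_mul_sum, hf, List.map_cons, List.prod_cons]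
  refine Finset.sum_congr rfl fun x _ ↦ Finset.sum_congr rfl fun T _ ↦
    Finset.sum_congr rfl fun ts _ ↦ ?_
  ring

lemma forestGF_add (p : ℕ → ℝ) (d : ℕ) (f g : List PTree → ℝ) :
    forestGF p d (fun ts ↦ f ts + g ts) = forestGF p d f + forestGF p d g := by
  ext n
  simp [forestGF, mul_add, Finset.sum_add_distrib]

lemma coeff_forestGF_of_lt (p : ℕ → ℝ) (f : List PTree → ℝ) {d n : ℕ} (h : n < d) :
    coeff n (forestGF p d f) = 0 := by
  rw [forestGF, coeff_mk]
  refine Finset.sum_eq_zero fun ts hts ↦ ?_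
  obtain ⟨hts, rfl⟩ := mem_forestFinset.1 hts
  have := PTree.length_le_sum_size ts
  omega

lemma coeff_succ_treeGF (p : ℕ → ℝ) (f : PTree → ℝ) (h : List PTree → ℝ)
    (hf : ∀ ts, f (.node ts) = h ts) {n N : ℕ} (hN : n < N) :
    coeff (n + 1) (treeGF p f) = ∑ d ∈ Finset.range N, p d * coeff n (forestGF p d h) := by
  have hsub : Finset.range (n + 1) ⊆ Finset.range N := Finset.range_subset_range.2 hN
  rw [← Finset.sum_subset hsub fun d _ hd ↦ ?_]
  · simp only [treeGF, forestGF, coeff_mk]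
    rw [sum_treeFinset_succ]
    refine Finset.sum_congr rfl fun d _ ↦ ?_
    rw [Finset.mul_sum]
    refine Finset.sum_congr rfl fun ts hts ↦ ?_
    obtain ⟨-, rfl⟩ := mem_forestFinset.1 hts
    rw [weight_node, hf ts]
    ring
  · rw [coeff_forestGF_of_lt p h (by simpa using hd), mul_zero]

lemma coeff_zero_treeGF (p : ℕ → ℝ) (f : PTree → ℝ) : coeff 0 (treeGF p f) = 0 := by
  rw [treeGF, coeff_mk]
  refine Finset.sum_eq_zero fun T hT ↦ ?_
  have := T.size_pos
  rw [mem_treeFinset] at hT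
  omega

/-- The total number of nodes of a forest whose subtree has size `k`. -/
noncomputable def forestZk (k : ℕ) (ts : List PTree) : ℝ := ((ts.map (Zk k)).sum : ℕ)

lemma forestZk_cons (k : ℕ) (T : PTree) (ts : List PTree) :
    forestZk k (T :: ts) = Zk k T + forestZk k ts := by
  simp [forestZk]

lemma forestGF_one (p : ℕ → ℝ) (d : ℕ) :
    forestGF p d (fun _ ↦ 1) = treeGF p (fun _ ↦ 1) ^ d := by
  induction d with
  | zero => simp [forestGF_zero]
  | succ d ih =>
    rw [forestGF_succ_mul p d (fun _ ↦ 1) (fun _ ↦ 1) _ (by simp), ih, pow_succ']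

lemma forestGF_forestZk (p : ℕ → ℝ) (k d : ℕ) :
    forestGF p (d + 1) (forestZk k)
      = C ((d : ℝ) + 1) * treeGF p (fun _ ↦ 1) ^ d * treeGF p (fun T ↦ Zk k T) := by
  have hsplit (d : ℕ) : forestGF p (d + 1) (forestZk k)
      = treeGF p (fun T ↦ Zk k T) * treeGF p (fun _ ↦ 1) ^ d
        + treeGF p (fun _ ↦ 1) * forestGF p d (forestZk k) := by
    rw [← forestGF_one,
      ← forestGF_succ_mul p d (fun T ↦ Zk k T) (fun _ ↦ 1)
        (fun ts ↦ Zk k (ts.headD (.node []))) (by simp),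
      ← forestGF_succ_mul p d (fun _ ↦ 1) (forestZk k) (fun ts ↦ forestZk k ts.tail) (by simp),
      ← forestGF_add]
    ext n
    simp only [forestGF, coeff_mk]
    refine Finset.sum_congr rfl fun ts hts ↦ ?_
    obtain _ | ⟨T, ts⟩ := ts
    · simp [mem_forestFinset] at hts
    · simp [forestZk_cons]
  induction d with
  | zero => simp [hsplit, forestGF_zero, forestZk]
  | succ d ih =>
    rw [hsplit, ih]
    push_cast
    simp only [map_add, map_one]
    ring

/-- The number of ordered pairs of distinct nodes of a forest whose subtrees have size `k`. -/
noncomputable def forestPairs (k : ℕ) (ts : List PTree) : ℝ := forestZk k ts * (forestZk k ts - 1)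

lemma forestGF_forestPairs (p : ℕ → ℝ) (k d : ℕ) :
    forestGF p (d + 1) (forestPairs k)
      = C ((d : ℝ) + 1) * treeGF p (fun _ ↦ 1) ^ d
          * treeGF p (fun T ↦ (Zk k T : ℝ) * ((Zk k T : ℝ) - 1))
        + C (((d : ℝ) + 1) * d) * treeGF p (fun _ ↦ 1) ^ (d - 1)
          * treeGF p (fun T ↦ Zk k T) ^ 2 := by
  have hsplit (d : ℕ) : forestGF p (d + 1) (forestPairs k)
      = treeGF p (fun T ↦ (Zk k T : ℝ) * ((Zk k T : ℝ) - 1)) * treeGF p (fun _ ↦ 1) ^ d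
        + 2 * (treeGF p (fun T ↦ Zk k T) * forestGF p d (forestZk k))
        + treeGF p (fun _ ↦ 1) * forestGF p d (forestPairs k) := by
    rw [two_mul, ← forestGF_one,
      ← forestGF_succ_mul p d (fun T ↦ (Zk k T : ℝ) * ((Zk k T : ℝ) - 1)) (fun _ ↦ 1)
        (fun ts ↦ (Zk k (ts.headD (.node [])) : ℝ) * ((Zk k (ts.headD (.node [])) : ℝ) - 1))
        (by simp),
      ← forestGF_succ_mul p d (fun T ↦ Zk k T) (forestZk k)
        (fun ts ↦ Zk k (ts.headD (.node [])) * forestZk k ts.tail) (by simp),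
      ← forestGF_succ_mul p d (fun _ ↦ 1) (forestPairs k) (fun ts ↦ forestPairs k ts.tail)
        (by simp),
      ← forestGF_add, ← forestGF_add, ← forestGF_add]
    ext n
    simp only [forestGF, coeff_mk]
    refine Finset.sum_congr rfl fun ts hts ↦ ?_
    obtain _ | ⟨T, ts⟩ := ts
    · simp [mem_forestFinset] at hts
    · simp only [forestPairs, forestZk_cons, List.headD_cons, List.tail_cons]
      ring
  induction d with
  | zero => simp [hsplit, forestGF_zero, forestZk, forestPairs]
  | succ d ih =>
    rw [hsplit, ih, forestGF_forestZk]
    obtain _ | d := d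
    · simp only [Nat.cast_one, Nat.cast_zero, zero_add, tsub_self, mul_zero, map_zero, map_add,
        map_mul, map_one]
      ring
    · simp only [Nat.cast_add, Nat.cast_one, add_tsub_cancel_right, map_add, map_mul, map_one]
      ring

section FunctionalEquations

variable (p : ℕ → ℝ) (Ψ : ℝ⟦X⟧ →ₐ[ℝ] ℝ⟦X⟧)

lemma constantCoeff_treeGF (f : PTree → ℝ) : constantCoeff (treeGF p f) = 0 := by
  rw [← coeff_zero_eq_constantCoeff_apply, coeff_zero_treeGF]

lemma treeGF_one_eq (hΨ : Ψ X = treeGF p (fun _ ↦ 1)) : Ψ X = X * Ψ (PowerSeries.mk p) := by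
  ext n
  obtain _ | n := n
  · simp [hΨ, constantCoeff_treeGF]
  · have h := coeff_algHom_mul Ψ (by rw [hΨ, constantCoeff_treeGF]) (PowerSeries.mk p) 1
      (Nat.lt_succ_self n)
    rw [mul_one] at h
    rw [coeff_succ_X_mul, h, hΨ, coeff_succ_treeGF p _ (fun _ ↦ 1) (fun _ ↦ rfl)
      (Nat.lt_succ_self n)]
    simp only [forestGF_one, coeff_mk, mul_one]

/-- The total number of nodes other than the root whose subtree has size `k`. -/
noncomputable def properZk (k : ℕ) : PTree → ℝ
  | .node ts => forestZk k ts

lemma treeGF_size_indicator (k : ℕ) :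
    treeGF p (fun T ↦ if T.size = k then 1 else 0)
      = C (coeff k (treeGF p (fun _ ↦ 1))) * X ^ k := by
  ext n
  rw [coeff_C_mul, coeff_X_pow, treeGF, treeGF, coeff_mk, coeff_mk]
  by_cases h : n = k
  · subst h
    rw [if_pos rfl, mul_one]
    refine Finset.sum_congr rfl fun T hT ↦ ?_
    rw [if_pos (mem_treeFinset.1 hT)]
  · rw [if_neg h, mul_zero]
    refine Finset.sum_eq_zero fun T hT ↦ ?_
    rw [mem_treeFinset.1 hT, if_neg h, mul_zero]

lemma treeGF_properZk (hΨ : Ψ X = treeGF p (fun _ ↦ 1)) (k : ℕ) :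
    treeGF p (properZk k)
      = X * (Ψ (d⁄dX ℝ (PowerSeries.mk p)) * treeGF p (fun T ↦ Zk k T)) := by
  ext n
  obtain _ | n := n
  · simp [constantCoeff_treeGF]
  · rw [coeff_succ_X_mul, coeff_algHom_mul Ψ (by rw [hΨ, constantCoeff_treeGF]) _ _
      (Nat.lt_succ_self n), coeff_succ_treeGF p _ (forestZk k) (fun _ ↦ rfl)
      (Nat.lt_succ_of_lt (Nat.lt_succ_self n)), Finset.sum_range_succ']
    simp only [forestGF_forestZk, forestGF_zero, coeff_derivative, coeff_mk, hΨ, mul_assoc,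
      coeff_C_mul]
    simp [forestZk]

lemma treeGF_Zk_eq (hΨ : Ψ X = treeGF p (fun _ ↦ 1)) (k : ℕ) :
    treeGF p (fun T ↦ Zk k T) = C (coeff k (treeGF p (fun _ ↦ 1))) * X ^ k
      + X * (Ψ (d⁄dX ℝ (PowerSeries.mk p)) * treeGF p (fun T ↦ Zk k T)) := by
  rw [← treeGF_properZk p Ψ hΨ, ← treeGF_size_indicator]
  ext n
  simp only [map_add, treeGF, coeff_mk, ← Finset.sum_add_distrib, ← mul_add]
  refine Finset.sum_congr rfl fun T _ ↦ ?_
  obtain ⟨ts⟩ := T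
  rw [Zk_node, Nat.cast_add, Nat.cast_ite, Nat.cast_one, Nat.cast_zero]
  rfl

lemma Zk_pairs_node (k : ℕ) (ts : List PTree) :
    (Zk k (.node ts) : ℝ) * ((Zk k (.node ts) : ℝ) - 1) = forestPairs k ts := by
  rw [forestPairs, forestZk, Zk_node]
  split_ifs with h
  · simp [sum_Zk_eq_zero k ts h.le]
  · simp

lemma treeGF_pairs_eq (hΨ : Ψ X = treeGF p (fun _ ↦ 1)) (k : ℕ) :
    treeGF p (fun T ↦ (Zk k T : ℝ) * ((Zk k T : ℝ) - 1))
      = X * (Ψ (d⁄dX ℝ (d⁄dX ℝ (PowerSeries.mk p))) * treeGF p (fun T ↦ Zk k T) ^ 2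
        + Ψ (d⁄dX ℝ (PowerSeries.mk p))
          * treeGF p (fun T ↦ (Zk k T : ℝ) * ((Zk k T : ℝ) - 1))) := by
  have hT : constantCoeff (Ψ X) = 0 := by rw [hΨ, constantCoeff_treeGF]
  ext n
  obtain _ | n := n
  · simp [constantCoeff_treeGF]
  · rw [coeff_succ_X_mul, map_add, coeff_algHom_mul Ψ hT _ _ (Nat.lt_succ_self n),
      coeff_algHom_mul Ψ hT _ _ (Nat.lt_succ_of_lt (Nat.lt_succ_self n)),
      coeff_succ_treeGF p _ (forestPairs k) (Zk_pairs_node k)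
        (Nat.lt_succ_of_lt (Nat.lt_succ_of_lt (Nat.lt_succ_self n))), Finset.sum_range_succ']
    have hcoeff (d : ℕ) : coeff n (forestGF p (d + 1) (forestPairs k))
        = ((d : ℝ) + 1) * coeff n (treeGF p (fun _ ↦ 1) ^ d
            * treeGF p (fun T ↦ (Zk k T : ℝ) * ((Zk k T : ℝ) - 1)))
          + ((d : ℝ) + 1) * d * coeff n (treeGF p (fun _ ↦ 1) ^ (d - 1)
            * treeGF p (fun T ↦ Zk k T) ^ 2) := by
      rw [forestGF_forestPairs, map_add, mul_assoc, mul_assoc, coeff_C_mul, coeff_C_mul]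
    have hzero : coeff n (forestGF p 0 (forestPairs k)) = 0 := by
      simp [forestGF_zero, forestPairs, forestZk]
    simp only [hcoeff, hzero, mul_zero, add_zero, mul_add (p _), Finset.sum_add_distrib]
    rw [add_comm]
    congr 1
    · rw [Finset.sum_range_succ' (n := n + 1)]
      simp only [Nat.cast_zero, mul_zero, zero_mul, add_zero]
      refine Finset.sum_congr rfl fun d _ ↦ ?_
      rw [coeff_derivative, coeff_derivative, coeff_mk, hΨ, add_tsub_cancel_right]
      push_cast
      ring
    · refine Finset.sum_congr rfl fun d _ ↦ ?_
      rw [coeff_derivative, coeff_mk, hΨ]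
      ring

end FunctionalEquations

end GeneratingFunctions

section Expectations

open PowerSeries

lemma tsum_size_eq (f : PTree → ℝ) (n : ℕ) :
    ∑' T : {T : PTree // T.size = n}, f T.1 = ∑ T ∈ treeFinset n, f T := by
  have h : {T : PTree | T.size = n} = (treeFinset n : Set PTree) := by
    ext T
    simp [mem_treeFinset]
  rw [← Finset.tsum_subtype]
  exact tsum_congr_set_coe f h

lemma treeSum_eq_coeff (p : ℕ → ℝ) (n : ℕ) :
    treeSum p n = coeff n (treeGF p (fun _ ↦ 1)) := by
  simp [treeSum, tsum_size_eq, treeGF]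

lemma condExp_eq_coeff (p : ℕ → ℝ) (n : ℕ) (f : PTree → ℝ) :
    condExp p n f = coeff n (treeGF p f) / treeSum p n := by
  rw [condExp, tsum_size_eq (fun T ↦ weight p T * f T), treeGF, coeff_mk]

/-- The substitution of the tree generating function into power series. -/
lemma exists_algHom_X_eq_treeGF (p : ℕ → ℝ) :
    ∃ Ψ : ℝ⟦X⟧ →ₐ[ℝ] ℝ⟦X⟧, Ψ X = treeGF p (fun _ ↦ 1) :=
  ⟨substAlgHom (HasSubst.of_constantCoeff_zero' (constantCoeff_treeGF p _)), substAlgHom_X _⟩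

/-- The Otter–Dwass formula. -/
lemma mul_treeSum_eq_walkProb (p : ℕ → ℝ) (n : ℕ) (hn : 1 ≤ n) :
    (n : ℝ) * treeSum p n = walkProb p n (-1) := by
  obtain ⟨Ψ, hΨ⟩ := exists_algHom_X_eq_treeGF p
  have hD : (1 - X * Ψ (d⁄dX ℝ (PowerSeries.mk p)))
      * (1 - X * Ψ (d⁄dX ℝ (PowerSeries.mk p)))⁻¹ = 1 :=
    PowerSeries.mul_inv_cancel _ (by simp)
  obtain ⟨m, rfl⟩ := Nat.exists_eq_add_of_le' hn
  have h := mul_coeff_lagrange_X Ψ _ (1 - X * Ψ (d⁄dX ℝ (PowerSeries.mk p)))⁻¹ (treeGF_one_eq p Ψ hΨ)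
    (by linear_combination hD) m
  rw [treeSum_eq_coeff, ← hΨ, walkProb_eq_coeff p (m + 1) m (-1) (by push_cast; ring), ← h]
  push_cast
  rfl

lemma coeff_treeGF_Zk (p : ℕ → ℝ) (n k : ℕ) (hkn : k ≤ n) :
    coeff n (treeGF p (fun T ↦ Zk k T)) = treeSum p k * walkProb p (n - k) 0 := by
  obtain ⟨Ψ, hΨ⟩ := exists_algHom_X_eq_treeGF p
  have hD : (1 - X * Ψ (d⁄dX ℝ (PowerSeries.mk p)))
      * (1 - X * Ψ (d⁄dX ℝ (PowerSeries.mk p)))⁻¹ = 1 :=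
    PowerSeries.mul_inv_cancel _ (by simp)
  set G := (1 - X * Ψ (d⁄dX ℝ (PowerSeries.mk p)))⁻¹
  have hA : treeGF p (fun T ↦ Zk k T)
      = C (coeff k (treeGF p (fun _ ↦ 1))) * (X ^ k * (Ψ 1 * G)) := by
    rw [map_one]
    linear_combination G * treeGF_Zk_eq p Ψ hΨ k - treeGF p (fun T ↦ (Zk k T : ℝ)) * hD
  have h := coeff_lagrange Ψ _ G (treeGF_one_eq p Ψ hΨ) (by linear_combination hD) (n - k) 1
  rw [hA, coeff_C_mul, coeff_X_pow_mul', if_pos hkn, h, one_mul, treeSum_eq_coeff,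
    walkProb_eq_coeff p (n - k) (n - k) 0 (add_zero _)]

lemma coeff_treeGF_pairs (p : ℕ → ℝ) (n k : ℕ) :
    coeff n (treeGF p (fun T ↦ (Zk k T : ℝ) * ((Zk k T : ℝ) - 1)))
      = if 2 * k ≤ n then
          treeSum p k ^ 2 * (((n - 2 * k : ℕ) + 1) * walkProb p (n - 2 * k) 1)
        else 0 := by
  obtain ⟨Ψ, hΨ⟩ := exists_algHom_X_eq_treeGF p
  have hD : (1 - X * Ψ (d⁄dX ℝ (PowerSeries.mk p)))
      * (1 - X * Ψ (d⁄dX ℝ (PowerSeries.mk p)))⁻¹ = 1 :=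
    PowerSeries.mul_inv_cancel _ (by simp)
  set G := (1 - X * Ψ (d⁄dX ℝ (PowerSeries.mk p)))⁻¹
  set q := coeff k (treeGF p (fun _ ↦ 1))
  have hA : treeGF p (fun T ↦ Zk k T) = C q * (X ^ k * G) := by
    linear_combination G * treeGF_Zk_eq p Ψ hΨ k - treeGF p (fun T ↦ (Zk k T : ℝ)) * hD
  set K := X * Ψ (d⁄dX ℝ (d⁄dX ℝ (PowerSeries.mk p))) * G ^ 3
  have hB : treeGF p (fun T ↦ (Zk k T : ℝ) * ((Zk k T : ℝ) - 1))
      = C (q ^ 2) * (X ^ (2 * k) * (Ψ (d⁄dX ℝ 1) * G ^ 2 + Ψ 1 * K)) := by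
    have h := treeGF_pairs_eq p Ψ hΨ k
    rw [hA] at h
    rw [derivative_one, map_one, map_zero, map_pow]
    linear_combination G * h
      - treeGF p (fun T ↦ (Zk k T : ℝ) * ((Zk k T : ℝ) - 1)) * hD
  have h := coeff_lagrange_second Ψ _ G K (treeGF_one_eq p Ψ hΨ) (by linear_combination hD)
    (by linear_combination X * Ψ (d⁄dX ℝ (d⁄dX ℝ (PowerSeries.mk p))) * G ^ 2 * hD) (n - 2 * k) 1
  rw [hB, coeff_C_mul, coeff_X_pow_mul', h, one_mul, treeSum_eq_coeff,
    walkProb_eq_coeff p (n - 2 * k) (n - 2 * k + 1) 1 (by push_cast; ring)]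
  split_ifs <;> simp [q]

end Expectations

/-- Janson: exact formulas for the first two factorial moments of `Z_k`
under the conditional Galton-Watson tree `τ_n`. -/
theorem stmt_0 (p : ℕ → ℝ)
    (hp_nonneg : ∀ i, 0 ≤ p i)
    (hp_sum : ∑' i : ℕ, p i = 1)
    (hp_mean : ∑' i : ℕ, (i : ℝ) * p i = 1)
    (hp_sq : Summable (fun i : ℕ => (i : ℝ) ^ 2 * p i))
    (hp_var : 1 < ∑' i : ℕ, (i : ℝ) ^ 2 * p i)
    (n : ℕ) (hn : n ∈ gwSupport p) (k : ℕ) (hk1 : 1 ≤ k) (hkn : k ≤ n) :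
    condExp p n (fun T => (Zk k T : ℝ)) =
        (n : ℝ) * walkProb p k (-1) * walkProb p (n - k) 0 / ((k : ℝ) * walkProb p n (-1))
      ∧ (2 * k + 1 ≤ n →
          condExp p n (fun T => (Zk k T : ℝ) * ((Zk k T : ℝ) - 1)) =
            (n : ℝ) * ((n : ℝ) - 2 * k + 1) * (walkProb p k (-1)) ^ 2 *
              walkProb p (n - 2 * k) 1 / ((k : ℝ) ^ 2 * walkProb p n (-1)))
      ∧ (n ≤ 2 * k →
          condExp p n (fun T => (Zk k T : ℝ) * ((Zk k T : ℝ) - 1)) = 0) := by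
  have hk0 : (k : ℝ) ≠ 0 := by positivity
  have hn0 : (n : ℝ) ≠ 0 := by
    have := hn.1
    positivity
  have hq : treeSum p n ≠ 0 := hn.2.ne'
  rw [← mul_treeSum_eq_walkProb p n hn.1, ← mul_treeSum_eq_walkProb p k hk1, condExp_eq_coeff,
    condExp_eq_coeff, coeff_treeGF_Zk p n k hkn, coeff_treeGF_pairs]
  refine ⟨by field_simp, fun h ↦ ?_, fun h ↦ ?_⟩
  · rw [if_pos (by omega), Nat.cast_sub (by omega)]
    push_cast
    field_simp
  · split_ifs with h2
    · have hzero : walkProb p 0 1 = 0 := by simp [walkProb]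
      rw [show n - 2 * k = 0 by omega, hzero]
      simp
    · simp
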